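/- arXiv:2212.10649 — 5 statements merged into one kernel-verified Lean document; each statement's English description precedes it below -/
import Mathlib

section
/- Let G=(N,E) and G'=(N,E') be DAGs on the same node set, with each state space X_s having at least two elements. If P^{G'} ⊇ P^G and E' ⊇ E* (G' contains all edges of G reversed), then the skeleton G'^∼ contains the moral graph G^M, and for every s ∈ N the vertex-induced subgraph G'[{s}∪des_G(s)] contains a perfect subgraph H_s (on nodes {s}∪des_G(s), with edges a subset of those of G'[{s}∪des_G(s)]) whose skeleton H_s^∼ contains G^M[{s}∪des_G(s)]. -/
open Finset

/-! Basic graph-theoretic definitions for Bayesian networks. -/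

/-- Two nodes are joined (adjacent) in the directed graph `E`. -/
def GJoined {V : Type*} (E : V → V → Prop) (a b : V) : Prop := E a b ∨ E b a

/-- A directed graph (given by its edge relation) is a DAG iff it has no cycles:
no node can reach itself by a nonempty directed walk. -/
def IsDAG {V : Type*} (E : V → V → Prop) : Prop := ∀ s, ¬ Relation.TransGen E s s

/-- The set of parents of `s`. -/
def paG {V : Type*} (E : V → V → Prop) (s : V) : Set V := {t | E t s}

/-- The set of children of `s`. -/
def chG {V : Type*} (E : V → V → Prop) (s : V) : Set V := {t | E s t}

/-- The set of descendants of `s` (nodes reachable from `s` by a nonempty directed path). -/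
def desG {V : Type*} (E : V → V → Prop) (s : V) : Set V := {t | Relation.TransGen E s t}

/-- A set of nodes is complete if all pairs of distinct elements are joined. -/
def GComplete {V : Type*} (E : V → V → Prop) (S : Set V) : Prop :=
  ∀ a ∈ S, ∀ b ∈ S, a ≠ b → GJoined E a b

/-- A directed graph is perfect if the parent set of every node is complete. -/
def GPerfect {V : Type*} (E : V → V → Prop) : Prop := ∀ s, GComplete E (paG E s)

/-- `a` and `b` are joined in the moral graph `G^M` of `E`:
either joined in `E` or distinct common parents of some node. -/
def MoralEdge {V : Type*} (E : V → V → Prop) (a b : V) : Prop :=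
  E a b ∨ E b a ∨ (a ≠ b ∧ ∃ s, E a s ∧ E b s)

/-- A topological ordering of a graph on a finite node set: an injective map into
`{1, …, |N|}` (encoded as `Fin (card V)`) increasing along edges. -/
def IsTopo {V : Type*} [Fintype V] (E : V → V → Prop) (O : V → Fin (Fintype.card V)) : Prop :=
  Function.Injective O ∧ ∀ s t, E s t → O s < O t

/-! d-separation. -/

/-- `u` is a v-structure (collider) of the trail `l` in the graph `E`. -/
def VStruct {V : Type*} (E : V → V → Prop) (l : List V) (u : V) : Prop :=
  ∃ l₁ l₂ a b, l = l₁ ++ a :: u :: b :: l₂ ∧ E a u ∧ E b u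

/-- `l` is a trail in the graph `E`: a nonempty sequence of distinct nodes consecutively joined. -/
def IsTrail {V : Type*} (E : V → V → Prop) (l : List V) : Prop :=
  l ≠ [] ∧ l.Nodup ∧ l.Chain' (GJoined E)

/-- The trail `l` is blocked by `S`. -/
def BlockedBy {V : Type*} (E : V → V → Prop) (S : Set V) (l : List V) : Prop :=
  ∃ u ∈ l, (u ∈ S ∧ ¬ VStruct E l u) ∨
    (VStruct E l u ∧ u ∉ S ∧ ∀ t ∈ desG E u, t ∉ S)

/-- d-separation: every trail from a node of `A` to a node of `B` is blocked by `S`. -/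
def DSep {V : Type*} (E : V → V → Prop) (A B S : Set V) : Prop :=
  ∀ (l : List V) (a b : V), IsTrail E l → l.head? = some a → l.getLast? = some b →
    a ∈ A → b ∈ B → BlockedBy E S l

/-- The set of leaves (childless nodes), as a `Finset`. -/
def leavesF {V : Type*} [Fintype V] (E : V → V → Prop) [DecidableRel E] : Finset V :=
  Finset.univ.filter fun s => ∀ t, ¬ E s t

/-! Probability on graphs (finite state spaces, pmfs). -/

section Prob

variable {V : Type*} [Fintype V] [DecidableEq V]
variable (X : V → Type*) [∀ v, Fintype (X v)]

/-- `p` is a probability mass function on `X_N = ∏ v, X v`. -/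
def IsPMF (p : (∀ v, X v) → ℝ) : Prop :=
  (∀ x, 0 ≤ p x) ∧ ∑ x, p x = 1

/-- `k` is a kernel function for the node `s` w.r.t. the graph `E`: it is nonnegative,
depends on the configuration only through the parents of `s` in `E`, and is normalized. -/
def IsKernel (E : V → V → Prop) (s : V) (k : X s → (∀ v, X v) → ℝ) : Prop :=
  (∀ a x, 0 ≤ k a x) ∧
  (∀ a x y, (∀ t, E t s → x t = y t) → k a x = k a y) ∧
  (∀ x, ∑ a, k a x = 1)

/-- `p` factorizes over the graph `E`: it is a product of kernel functions, one per node. -/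
def Factorizes (E : V → V → Prop) (p : (∀ v, X v) → ℝ) : Prop :=
  ∃ k : ∀ s, X s → (∀ v, X v) → ℝ,
    (∀ s, IsKernel X E s (k s)) ∧ ∀ x, p x = ∏ s, k s (x s) x

variable [∀ v, DecidableEq (X v)]

/-- The marginal of `p` on the coordinates in `C`, evaluated at (the `C`-part of) `x`. -/
def marg (p : (∀ v, X v) → ℝ) (C : Finset V) (x : ∀ v, X v) : ℝ :=
  ∑ y, if ∀ v ∈ C, y v = x v then p y else 0

/-- Conditional independence `A ⟂⟂ B ∣ S` w.r.t. the pmf `p`. -/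
def CondIndep (p : (∀ v, X v) → ℝ) (A B S : Finset V) : Prop :=
  ∀ x, 0 < marg X p S x →
    marg X p (A ∪ B ∪ S) x * marg X p S x = marg X p (A ∪ S) x * marg X p (B ∪ S) x

/-- `q` is a conditional system for `N ∖ A` given `A`: a family of pmfs on `X_{N∖A}`,
one for every configuration on `A`.  Here `q x` encodes `q(x_{N∖A} ∣ x_A)`. -/
def IsCondSystem (A : Finset V) (q : (∀ v, X v) → ℝ) : Prop :=
  (∀ x, 0 ≤ q x) ∧ ∀ x : ∀ v, X v, (∑ y, if ∀ v ∈ A, y v = x v then q y else 0) = 1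

/-- The conditional system `q` for `N ∖ A` given `A` factorizes over the graph `E`. -/
def CondFactorizes (E : V → V → Prop) (A : Finset V) (q : (∀ v, X v) → ℝ) : Prop :=
  ∃ k : ∀ s, X s → (∀ v, X v) → ℝ,
    (∀ s ∉ A, IsKernel X E s (k s)) ∧ ∀ x, q x = ∏ s ∈ Finset.univ \ A, k s (x s) x

/-- The conditional system `q` for `N ∖ A` given `A` is a version of the conditional
distribution of the pmf `p`. -/
def IsVersionOf (A : Finset V) (q p : (∀ v, X v) → ℝ) : Prop :=
  ∀ x, p x = q x * marg X p A x

/-- `G'` (edges `E'`) satisfies Goal I for `G` (edges `E`): `roots(G') ⊇ leaves(G)` and for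
every pmf factorizing over `G` there is a conditional system for `N ∖ leaves(G)` given
`leaves(G)` factorizing over `G'` which is a version of its conditional distribution. -/
def GoalI (E E' : V → V → Prop) [DecidableRel E] : Prop :=
  (∀ s ∈ leavesF E, ∀ t, ¬ E' t s) ∧
  ∀ p : (∀ v, X v) → ℝ, IsPMF X p → Factorizes X E p →
    ∃ q, IsCondSystem X (leavesF E) q ∧ CondFactorizes X E' (leavesF E) q ∧
      IsVersionOf X (leavesF E) q p

/-- `G'` (edges `E'`) satisfies Goal II for `G` (edges `E`): `P^{G'} ⊇ P^G` and every parent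
in `G'` of a leaf of `G` is itself a leaf of `G`. -/
def GoalII (E E' : V → V → Prop) : Prop :=
  (∀ p : (∀ v, X v) → ℝ, IsPMF X p → Factorizes X E p → Factorizes X E' p) ∧
  ∀ s t, (∀ u, ¬ E s u) → E' t s → ∀ u, ¬ E t u

end Prob

/-- The vertices of a finite DAG can be numbered injectively so that edges increase. -/
lemma IsDAG.exists_rank {V : Type*} [Fintype V] {E : V → V → Prop} (hE : IsDAG E) :
    ∃ O : V → ℕ, Function.Injective O ∧ ∀ a b, E a b → O a < O b := by
  classical
  have hpo : IsPartialOrder V (Relation.ReflTransGen E) :=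
    { refl := fun _ => .refl
      trans := fun _ _ _ => .trans
      antisymm := fun a b hab hba => by
        rcases Relation.reflTransGen_iff_eq_or_transGen.1 hab with h | h
        · exact h.symm
        · exact absurd (h.trans_left hba) (hE a) }
  obtain ⟨le, hle, hsub⟩ := extend_partialOrder (Relation.ReflTransGen E)
  have hmono : ∀ a b, le a b → a ≠ b →
      #{x | le x a ∧ x ≠ a} < #{x | le x b ∧ x ≠ b} := by
    intro a b hab hne
    refine Finset.card_lt_card (Finset.ssubset_iff_subset_ne.2 ⟨fun x hx => ?_, fun h => ?_⟩)
    · simp only [Finset.mem_filter, Finset.mem_univ, true_and] at hx ⊢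
      refine ⟨_root_.trans hx.1 hab, ?_⟩
      rintro rfl
      exact hx.2 (antisymm hx.1 hab)
    · have : a ∈ ({x | le x b ∧ x ≠ b} : Finset V) := by simp [hab, hne]
      rw [← h] at this
      simp at this
  refine ⟨fun v => #{x | le x v ∧ x ≠ v}, fun a b hab => ?_, fun a b hab => ?_⟩
  · by_contra hne
    rcases total_of le a b with h | h
    · exact (hmono a b h hne).ne hab
    · exact (hmono b a h (Ne.symm hne)).ne hab.symm
  · refine hmono a b (hsub _ _ (.single hab)) ?_
    rintro rfl
    exact hE a (.single hab)

section Kernels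

variable {V : Type*} [Fintype V] [DecidableEq V] {X : V → Type*} [∀ v, Fintype (X v)]

lemma sum_sum_update (m : V) (h : (∀ v, X v) → ℝ) :
    ∑ x, ∑ a, h (Function.update x m a) = Fintype.card (X m) * ∑ x, h x := by
  have hinv : Function.Involutive
      (fun q : (∀ v, X v) × X m => (Function.update q.1 m q.2, q.1 m)) := by
    rintro ⟨x, a⟩
    simp
  have := Equiv.sum_comp hinv.toPerm (fun q : (∀ v, X v) × X m => h q.1)
  simp only [Function.Involutive.coe_toPerm, Fintype.sum_prod_type] at this
  rw [this]
  simp [Finset.mul_sum]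

/-- A kernel can be replaced by the uniform distribution when summing against a function
not depending on its coordinate. -/
lemma card_mul_sum_kernel_mul (m : V) (f : X m → (∀ v, X v) → ℝ) (g : (∀ v, X v) → ℝ)
    (hf : ∀ a x b, f a (Function.update x m b) = f a x)
    (hg : ∀ x b, g (Function.update x m b) = g x) (hsum : ∀ x, ∑ a, f a x = 1) :
    Fintype.card (X m) * ∑ x, f (x m) x * g x = ∑ x, g x := by
  rw [← sum_sum_update m (fun x => f (x m) x * g x)]
  simp [hf, hg, ← Finset.sum_mul, hsum]

/-- A product of kernels over a DAG is a probability mass function. -/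
lemma sum_prod_kernel_eq_one [∀ v, Nonempty (X v)] {E : V → V → Prop} (hE : IsDAG E)
    {k : ∀ s, X s → (∀ v, X v) → ℝ} (hk : ∀ s, IsKernel X E s (k s)) :
    ∑ x : ∀ v, X v, ∏ s, k s (x s) x = 1 := by
  obtain ⟨O, -, hO⟩ := hE.exists_rank
  have key : ∀ A : Finset V, ∑ x : ∀ v, X v,
      ((∏ s ∈ A, k s (x s) x) * ∏ s ∈ Aᶜ, (Fintype.card (X s) : ℝ)⁻¹) = 1 := by
    intro A
    induction A using Finset.strongInduction with
    | H A ih =>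
      rcases A.eq_empty_or_nonempty with rfl | hne
      · simp [Finset.prod_inv_distrib]
        refine mul_inv_cancel₀ (Finset.prod_ne_zero_iff.2 fun v _ => ?_)
        exact Nat.cast_ne_zero.2 Fintype.card_ne_zero
      · obtain ⟨m, hm, hmax⟩ := A.exists_max_image O hne
        have h1 := ih (A.erase m) (Finset.erase_ssubset hm)
        have hc : (Fintype.card (X m) : ℝ) ≠ 0 := Nat.cast_ne_zero.2 Fintype.card_ne_zero
        have h2 := card_mul_sum_kernel_mul m (k m)
          (fun x => (∏ s ∈ A.erase m, k s (x s) x) * ∏ s ∈ Aᶜ, (Fintype.card (X s) : ℝ)⁻¹)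
          (fun a x b => (hk m).2.1 a _ _ fun t ht => Function.update_of_ne
            (by rintro rfl; exact (hO _ _ ht).false) _ _)
          (fun x b => by
            refine congrArg (fun r : ℝ => r * _) (Finset.prod_congr rfl fun s hs => ?_)
            rw [Function.update_of_ne (Finset.ne_of_mem_erase hs)]
            refine (hk s).2.1 _ _ _ fun t ht => Function.update_of_ne ?_ _ _
            rintro rfl
            exact ((hO _ _ ht).trans_le (hmax s (Finset.mem_of_mem_erase hs))).false)
          (hk m).2.2
        rw [Finset.compl_erase] at h1
        simp only [Finset.prod_insert (show m ∉ Aᶜ by simpa using hm)] at h1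
        have h3 : ∀ x : ∀ v, X v,
            k m (x m) x * ∏ s ∈ A.erase m, k s (x s) x = ∏ s ∈ A, k s (x s) x :=
          fun x => Finset.mul_prod_erase A (fun s => k s (x s) x) hm
        simp only [← mul_assoc, h3] at h2
        rw [← h1]
        refine mul_left_cancel₀ hc (h2.trans ?_)
        rw [Finset.mul_sum]
        refine Finset.sum_congr rfl fun x _ => ?_
        field_simp
  simpa using key Finset.univ

/-- A configuration with positive kernel values on a parent-closed set extends, keeping its
values on that set, to one with positive kernel values everywhere. -/
lemma exists_extension_pos {E : V → V → Prop} (hE : IsDAG E)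
    {k : ∀ s, X s → (∀ v, X v) → ℝ} (hk : ∀ s, IsKernel X E s (k s))
    (A : Finset V) (hA : ∀ a b, E a b → b ∈ A → a ∈ A)
    (x : ∀ v, X v) (hx : ∀ v ∈ A, 0 < k v (x v) x) :
    ∃ y : ∀ v, X v, (∀ v ∈ A, y v = x v) ∧ ∀ v, 0 < k v (y v) y := by
  obtain ⟨O, -, hO⟩ := hE.exists_rank
  induction hn : #Aᶜ generalizing A x with
  | zero =>
    have : A = Finset.univ := by simpa using hn
    subst this
    exact ⟨x, fun _ _ => rfl, fun v => hx v (Finset.mem_univ v)⟩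
  | succ n ih =>
    obtain ⟨m, hm, hmin⟩ := Aᶜ.exists_min_image O (Finset.card_pos.1 (by omega))
    have hpa : ∀ a, E a m → a ∈ A := fun a ha => by
      by_contra h
      exact ((hO _ _ ha).trans_le (hmin a (Finset.mem_compl.2 h))).false
    have hmA : m ∉ A := Finset.mem_compl.1 hm
    obtain ⟨a, ha⟩ : ∃ a, 0 < k m a x := by
      by_contra! h
      have := (hk m).2.2 x
      linarith [Finset.sum_nonpos fun a (_ : a ∈ Finset.univ) => h a]
    have hagree : ∀ v ∈ A, Function.update x m a v = x v := fun v hv =>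
      Function.update_of_ne (by rintro rfl; exact hmA hv) _ _
    obtain ⟨y, hy, hpos⟩ := ih (insert m A)
      (fun b c hbc hc => by
        rcases Finset.mem_insert.1 hc with rfl | hc
        · exact Finset.mem_insert_of_mem (hpa b hbc)
        · exact Finset.mem_insert_of_mem (hA b c hbc hc))
      (Function.update x m a)
      (fun v hv => by
        rcases Finset.mem_insert.1 hv with rfl | hv
        · rw [Function.update_self,
            (hk v).2.1 a _ x fun t ht => hagree t (hpa t ht)]
          exact ha
        · rw [hagree v hv, (hk v).2.1 _ _ x fun t ht => hagree t (hA t v ht hv)]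
          exact hx v hv)
      (by rw [Finset.compl_insert, Finset.card_erase_of_mem hm, hn]; rfl)
    exact ⟨y, fun v hv => (hy v (Finset.mem_insert_of_mem hv)).trans (hagree v hv), hpos⟩

/-- Every system of nonempty local constraints `R`, each depending only on the parents, is the
support of a pmf factorizing over the DAG. -/
lemma exists_factorizes_pos_iff [∀ v, Nonempty (X v)] {E : V → V → Prop} (hE : IsDAG E)
    (R : ∀ v, X v → (∀ v, X v) → Prop)
    (hdep : ∀ v a x y, (∀ t, E t v → x t = y t) → (R v a x ↔ R v a y))
    (hne : ∀ v x, ∃ a, R v a x) :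
    ∃ p, IsPMF X p ∧ Factorizes X E p ∧ ∀ x, 0 < p x ↔ ∀ v, R v (x v) x := by
  classical
  let k : ∀ s, X s → (∀ v, X v) → ℝ := fun s a x =>
    if R s a x then (#{b | R s b x} : ℝ)⁻¹ else 0
  have hcard : ∀ s x, 0 < #{b | R s b x} := fun s x => by
    obtain ⟨a, ha⟩ := hne s x
    exact Finset.card_pos.2 ⟨a, by simpa using ha⟩
  have hnn : ∀ s a x, 0 ≤ k s a x := fun s a x => by
    simp only [k]; split_ifs <;> positivity
  have hk : ∀ s, IsKernel X E s (k s) := by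
    refine fun s => ⟨hnn s, fun a x y hxy => ?_, fun x => ?_⟩
    · simp only [k, hdep s _ x y hxy]
    · simp only [k, ← Finset.sum_filter, Finset.sum_const, nsmul_eq_mul]
      exact mul_inv_cancel₀ (Nat.cast_ne_zero.2 (hcard s x).ne')
  refine ⟨fun x => ∏ s, k s (x s) x, ⟨fun x => Finset.prod_nonneg fun s _ => hnn s _ _,
    sum_prod_kernel_eq_one hE hk⟩, ⟨k, hk, fun _ => rfl⟩, fun x => ⟨fun h v => ?_, fun h => ?_⟩⟩
  · by_contra hv
    exact h.ne' (Finset.prod_eq_zero (Finset.mem_univ v) (if_neg hv))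
  · refine Finset.prod_pos fun s _ => ?_
    simp only [k, if_pos (h s)]
    exact inv_pos.2 (Nat.cast_pos.2 (hcard s x))

/-- If `u` has no edge from its predecessor `w`, then two support points agreeing on the other
predecessors of `u` can be spliced at `u`. -/
lemma Factorizes.exists_splice {E : V → V → Prop} (hE : IsDAG E) {p : (∀ v, X v) → ℝ}
    (hp : Factorizes X E p) {O : V → ℕ} (hO : ∀ a b, E a b → O a < O b) {u w : V}
    (hwu : ¬ E w u) {y z : ∀ v, X v} (hy : 0 < p y) (hz : 0 < p z)
    (hyz : ∀ v, O v < O u → v ≠ w → y v = z v) (hinj : Function.Injective O) :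
    ∃ x, 0 < p x ∧ (∀ v, O v < O u → x v = y v) ∧ x u = z u := by
  obtain ⟨k, hk, hpk⟩ := hp
  have hpos : ∀ x, 0 < p x → ∀ v, 0 < k v (x v) x := fun x hx v => by
    refine lt_of_le_of_ne ((hk v).1 _ _) fun h => hx.ne' ?_
    rw [hpk]
    exact Finset.prod_eq_zero (Finset.mem_univ v) h.symm
  have hagree : ∀ v, O v < O u → Function.update y u (z u) v = y v := fun v hv =>
    Function.update_of_ne (by rintro rfl; exact hv.false) _ _
  obtain ⟨x, hx, hxpos⟩ := exists_extension_pos hE hk {v | O v ≤ O u}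
    (fun a b hab hb => by
      simp only [Finset.mem_filter, Finset.mem_univ, true_and] at hb ⊢
      exact ((hO a b hab).trans_le hb).le)
    (Function.update y u (z u))
    (fun v hv => by
      simp only [Finset.mem_filter, Finset.mem_univ, true_and] at hv
      rcases hv.lt_or_eq with hlt | heq
      · rw [hagree v hlt, (hk v).2.1 _ _ y fun t ht => hagree t ((hO t v ht).trans hlt)]
        exact hpos y hy v
      · obtain rfl := hinj heq
        rw [Function.update_self, (hk v).2.1 _ _ z fun t ht => ?_]
        · exact hpos z hz v
        · rw [hagree t (hO t v ht)]
          exact hyz t (hO t v ht) (by rintro rfl; exact hwu ht))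
  refine ⟨x, by rw [hpk]; exact Finset.prod_pos fun v _ => hxpos v, fun v hv => ?_, ?_⟩
  · rw [hx v (by simpa using hv.le), hagree v hv]
  · rw [hx u (by simp), Function.update_self]

end Kernels

section Join

variable {V : Type*} [Fintype V] [DecidableEq V] {X : V → Type*} [∀ v, Fintype (X v)]
  {E E' : V → V → Prop}

/-- Let the nodes not preceding `u` (in the ordering `O`) among `s` and its descendants
copy the value of `s`, and let the other
nodes satisfy constraints `Q` compatible with the all-`c₀` configuration and with the
configuration that is `c₁` on the copying nodes and `w`. If `Q` forces the value of the copying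
nodes to be determined by the predecessors of `u`, then `G'` has an edge `w → u`. -/
lemma edge_of_copy (hE : IsDAG E) (hE' : IsDAG E')
    (hPP : ∀ p : (∀ v, X v) → ℝ, IsPMF X p → Factorizes X E p → Factorizes X E' p)
    (hrev : ∀ s t, E s t → E' t s)
    {O : V → ℕ} (hinj : Function.Injective O) (hO : ∀ a b, E' a b → O a < O b)
    {c₀ c₁ : ∀ v, X v} (hc : ∀ v, c₀ v ≠ c₁ v)
    {s u v₀ w : V} (hu : u ∈ insert s (desG E s)) (hv₀ : v₀ ∈ insert s (desG E s))
    (huv : O u ≤ O v₀)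
    (Q : ∀ v, X v → (∀ v, X v) → Prop)
    (hdep : ∀ v a x y, (∀ t, E t v → x t = y t) → (Q v a x ↔ Q v a y))
    (hne : ∀ v x, ∃ a, Q v a x) (hQ₀ : ∀ v, Q v (c₀ v) c₀)
    (hQ₁ : ∀ z : ∀ v, X v, z v₀ = c₁ v₀ → z w = c₁ w →
      ∀ v, (v ≠ w → z v = c₀ v) → Q v (z v) z)
    (hcontra : ∀ x : ∀ v, X v, (∀ v, O v < O u → Q v (x v) x) →
      (∀ v, O v < O u → x v = c₀ v) → x v₀ ≠ c₁ v₀) :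
    E' w u := by
  classical
  by_contra hnot
  have : ∀ v, Nonempty (X v) := fun v => ⟨c₀ v⟩
  set L : V → Prop := fun v => v ∈ insert s (desG E s) ∧ O u ≤ O v with hL
  have hparent : ∀ v, ∃ b, L v → v ≠ s → E b v ∧ L b := by
    intro v
    by_cases hv : L v ∧ v ≠ s
    · obtain ⟨⟨hD, hle⟩, hvs⟩ := hv
      obtain ⟨b, hsb, hbv⟩ := Relation.TransGen.tail'_iff.1 (hD.resolve_left hvs)
      refine ⟨b, fun _ _ => ⟨hbv, ?_, hle.trans (hO _ _ (hrev _ _ hbv)).le⟩⟩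
      exact Relation.reflTransGen_iff_eq_or_transGen.1 hsb
    · exact ⟨v, fun h1 h2 => absurd ⟨h1, h2⟩ hv⟩
  choose π hπ using hparent
  have hlt : ∀ v, O v < O u → ¬ L v := fun v hv h => (hv.trans_le h.2).false
  let R : ∀ v, X v → (∀ v, X v) → Prop := fun v a x =>
    if L v then v = s ∨ a = if x (π v) = c₁ (π v) then c₁ v else c₀ v else Q v a x
  obtain ⟨p, hp, hpE, hpos⟩ := exists_factorizes_pos_iff hE R
    (fun v a x y hxy => by
      by_cases hv : L v
      · by_cases hs : v = s
        · simp [R, hs ▸ hv, hs]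
        · simp only [R, if_pos hv, hxy _ (hπ v hv hs).1]
      · simp only [R, if_neg hv]
        exact hdep v a x y hxy)
    (fun v x => by
      by_cases hv : L v
      · simp only [R, if_pos hv]
        exact ⟨_, .inr rfl⟩
      · simp only [R, if_neg hv]
        exact hne v x)
  let z : ∀ v, X v := fun v => if L v ∨ v = w then c₁ v else c₀ v
  have hy : 0 < p c₀ := (hpos _).2 fun v => by
    by_cases hv : L v
    · simp [R, hv, hc]
    · simpa only [R, if_neg hv] using hQ₀ v
  have hzL : ∀ v, L v → z v = c₁ v := fun v hv => if_pos (.inl hv)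
  have hz : 0 < p z := (hpos _).2 fun v => by
    by_cases hv : L v
    · simp only [R, if_pos hv]
      refine or_iff_not_imp_left.2 fun hs => ?_
      rw [hzL v hv, if_pos (hzL _ (hπ v hv hs).2)]
    · simp only [R, if_neg hv]
      exact hQ₁ z (hzL _ ⟨hv₀, huv⟩) (if_pos (.inr rfl)) v fun hvw => if_neg (by tauto)
  obtain ⟨x, hx, hxy, hxz⟩ := (hPP p hp hpE).exists_splice hE' hO hnot hy hz
    (fun v hv hvw => (if_neg (not_or.2 ⟨hlt v hv, hvw⟩)).symm) hinj
  have hR := (hpos x).1 hx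
  obtain ⟨r, -, hr⟩ := hE.exists_rank
  have hcopy : ∀ n v, r v = n → L v → (x v = c₁ v ↔ x s = c₁ s) := by
    intro n
    induction n using Nat.strong_induction_on with
    | _ n ih =>
      rintro v rfl hv
      by_cases hs : v = s
      · rw [hs]
      · have h := hR v
        simp only [R, if_pos hv, hs, false_or] at h
        obtain ⟨hE₁, hL₁⟩ := hπ v hv hs
        rw [← ih _ (hr _ _ hE₁) _ rfl hL₁, h]
        split_ifs with h1 <;> simp [h1, hc]
  refine hcontra x (fun v hv => ?_) hxy ?_
  · simpa only [R, if_neg (hlt v hv)] using hR v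
  · rw [hcopy _ _ rfl ⟨hv₀, huv⟩, ← hcopy _ u rfl ⟨hu, le_rfl⟩, hxz]
    exact hzL u ⟨hu, le_rfl⟩

/-- If `w < u ≤ v` in a topological ordering of `G'`, where `u` and `v` belong to `s` and its
descendants and `v`, `w` are adjacent in the moral graph of `G`, then `G'` has an edge `w → u`. -/
lemma edge_of_moralEdge (h2 : ∀ v, 1 < Fintype.card (X v)) (hE : IsDAG E) (hE' : IsDAG E')
    (hPP : ∀ p : (∀ v, X v) → ℝ, IsPMF X p → Factorizes X E p → Factorizes X E' p)
    (hrev : ∀ s t, E s t → E' t s)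
    {O : V → ℕ} (hinj : Function.Injective O) (hO : ∀ a b, E' a b → O a < O b)
    {s u v w : V} (hu : u ∈ insert s (desG E s)) (hv : v ∈ insert s (desG E s))
    (huv : O u ≤ O v) (hwu : O w < O u) (hm : MoralEdge E w v) : E' w u := by
  classical
  choose c₀ c₁ hc using fun v => Fintype.exists_pair_of_one_lt_card (h2 v)
  have hrank : ∀ a b, E a b → O b < O a := fun a b h => hO _ _ (hrev _ _ h)
  rcases hm with h | h | ⟨-, t, hwt, hvt⟩
  · exact absurd (hrank _ _ h) (by omega)
  · refine edge_of_copy hE hE' hPP hrev hinj hO hc hu hv huv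
      (fun b a x => a = if b = w ∧ x v = c₁ v then c₁ b else c₀ b) ?_ ?_ ?_ ?_ ?_
    · intro b a x y hxy
      by_cases hb : b = w
      · subst hb
        rw [hxy v h]
      · simp [hb]
    · exact fun b x => ⟨_, rfl⟩
    · simp [hc]
    · intro z hzv hzw b hb
      by_cases hbw : b = w
      · subst hbw
        simp [hzv, hzw]
      · simp [hbw, hb hbw]
    · intro x hQ hx hxv
      have := hQ w hwu
      rw [hx w hwu, if_pos ⟨rfl, hxv⟩] at this
      exact hc w this
  · have htw := hrank _ _ hwt
    have htw' : t ≠ w := by rintro rfl; exact htw.false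
    refine edge_of_copy hE hE' hPP hrev hinj hO hc hu hv huv
      (fun b a x => b = w ∨ a = if b = t ∧ ¬ (x v = c₁ v ↔ x w = c₁ w) then c₁ b else c₀ b)
      ?_ ?_ ?_ ?_ ?_
    · intro b a x y hxy
      by_cases hb : b = t
      · subst hb
        rw [hxy v hvt, hxy w hwt]
      · simp [hb]
    · exact fun b x => ⟨_, .inr rfl⟩
    · simp [hc]
    · intro z hzv hzw b hb
      by_cases hbw : b = w
      · exact .inl hbw
      · simp [hzv, hzw, hb hbw]
    · intro x hQ hx hxv
      have := (hQ t (htw.trans hwu)).resolve_left htw'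
      rw [hx t (htw.trans hwu), hx w hwu, if_pos ⟨rfl, by simp [hxv, hc]⟩] at this
      exact hc t this

end Join

/-- if `P^{G'} ⊇ P^G` and `G' ⊇ G*`, then the skeleton of `G'` contains the
moral graph of `G`, and for every node `s` the induced subgraph `G'[{s} ∪ des_G(s)]`
contains a perfect subgraph `H_s` whose skeleton contains `G^M[{s} ∪ des_G(s)]`. -/
theorem stmt10 {V : Type*} [Fintype V] [DecidableEq V] [Nonempty V]
    (X : V → Type*) [∀ v, Fintype (X v)] (h2 : ∀ v, 1 < Fintype.card (X v))
    (E E' : V → V → Prop) (hE : IsDAG E) (hE' : IsDAG E')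
    (hPP : ∀ p : (∀ v, X v) → ℝ, IsPMF X p → Factorizes X E p → Factorizes X E' p)
    (hrev : ∀ s t, E s t → E' t s) :
    (∀ a b, MoralEdge E a b → GJoined E' a b) ∧
    ∀ s : V, ∃ F : V → V → Prop,
      (∀ a b, F a b →
        E' a b ∧ a ∈ insert s (desG E s) ∧ b ∈ insert s (desG E s)) ∧
      GPerfect F ∧
      ∀ a b, a ∈ insert s (desG E s) → b ∈ insert s (desG E s) →
        MoralEdge E a b → GJoined F a b := by
  obtain ⟨O, hinj, hO⟩ := hE'.exists_rank
  have hedge : ∀ {s u v w : V}, u ∈ insert s (desG E s) → v ∈ insert s (desG E s) →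
      O u ≤ O v → O w < O u → MoralEdge E w v → E' w u :=
    edge_of_moralEdge h2 hE hE' hPP hrev hinj hO
  have hsymm : ∀ {a b}, MoralEdge E a b → MoralEdge E b a := by
    rintro a b (h | h | ⟨hne, t, ha, hb⟩)
    exacts [.inr (.inl h), .inl h, .inr (.inr ⟨hne.symm, t, hb, ha⟩)]
  have hmoral_ne : ∀ {a b}, MoralEdge E a b → a ≠ b := by
    rintro a b (h | h | ⟨hne, -⟩) rfl
    exacts [hE _ (.single h), hE _ (.single h), hne rfl]
  have hlt : ∀ {a b}, MoralEdge E a b → O a < O b → E' a b := fun {a b} hm hab =>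
    hedge (Set.mem_insert b _) (Set.mem_insert b _) le_rfl hab hm
  refine ⟨fun a b hm => ?_, fun s => ⟨fun w u => w ∈ insert s (desG E s) ∧
    u ∈ insert s (desG E s) ∧ E' w u ∧ ∃ v ∈ insert s (desG E s), O u ≤ O v ∧ MoralEdge E w v,
    fun a b h => ⟨h.2.2.1, h.1, h.2.1⟩, ?_, fun a b ha hb hm => ?_⟩⟩
  · rcases lt_or_gt_of_ne (hinj.ne (hmoral_ne hm)) with h | h
    exacts [.inl (hlt hm h), .inr (hlt (hsymm hm) h)]
  · have key : ∀ c a b, O a < O b → a ∈ insert s (desG E s) → b ∈ insert s (desG E s) →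
        E' b c → (∃ v ∈ insert s (desG E s), O c ≤ O v ∧ MoralEdge E a v) →
        E' a b ∧ ∃ v ∈ insert s (desG E s), O b ≤ O v ∧ MoralEdge E a v := by
      rintro c a b hab ha hb hbc ⟨v, hv, hcv, hm⟩
      have hbv := (hO _ _ hbc).le.trans hcv
      exact ⟨hedge hb hv hbv hab hm, v, hv, hbv, hm⟩
    rintro c a ⟨ha, -, hac, hav⟩ b ⟨hb, -, hbc, hbv⟩ hne
    rcases lt_or_gt_of_ne (hinj.ne hne) with h | h
    exacts [.inl ⟨ha, hb, key c a b h ha hb hbc hav⟩, .inr ⟨hb, ha, key c b a h hb ha hac hbv⟩]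
  · rcases lt_or_gt_of_ne (hinj.ne (hmoral_ne hm)) with h | h
    exacts [.inl ⟨ha, hb, hlt hm h, b, hb, le_rfl, hm⟩,
      .inr ⟨hb, ha, hlt (hsymm hm) h, a, ha, le_rfl, hsymm hm⟩]
end

section
/- Let G=(N,E) and G'=(N,E') be DAGs on the same node set, with each state space X_s having at least two elements. If P^{G'} ⊇ P^G and E' ⊇ E* (G' contains all edges of G reversed), then the skeleton G'^∼ contains the moral graph G^M; in particular any two distinct parents in G of a common node are joined in G'. -/
open Finset

theorem IsDAG.exists_no_child {V : Type*} [Finite V] {E : V → V → Prop} (hE : IsDAG E)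
    {S : Finset V} (hS : S.Nonempty) : ∃ m ∈ S, ∀ v ∈ S, ¬ E m v := by
  let r : V → V → Prop := fun a b => Relation.TransGen E b a
  have : IsTrans V r := ⟨fun _ _ _ h₁ h₂ => Relation.TransGen.trans h₂ h₁⟩
  have : Std.Irrefl r := ⟨hE⟩
  have wf : WellFounded r := Finite.wellFounded_of_trans_of_irrefl r
  obtain ⟨m, hm, h⟩ := wf.has_min (S : Set V) hS
  exact ⟨m, hm, fun v hv e => h v hv (Relation.TransGen.single e)⟩

section Kernels

variable {V : Type*} {X : V → Type*} [∀ v, Fintype (X v)] {E : V → V → Prop}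

theorem IsKernel.le_one {s : V} {k : X s → (∀ v, X v) → ℝ} (hk : IsKernel X E s k)
    (a : X s) (x : ∀ v, X v) : k a x ≤ 1 := by
  rw [← hk.2.2 x]
  exact Finset.single_le_sum (f := fun a => k a x) (fun b _ => hk.1 b x) (Finset.mem_univ a)

open Classical in
/-- The kernel concentrated on a point is a kernel with respect to any graph. -/
theorem isKernel_pointMass (s : V) (a : X s) :
    IsKernel X E s (fun y _ => if y = a then 1 else 0) :=
  ⟨fun _ _ => by positivity, fun _ _ _ _ => rfl, fun _ => by simp⟩

variable [Fintype V] [DecidableEq V]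

/-- A normalized factor in the coordinate `m` can be summed out. -/
theorem sum_mul_kernel [∀ v, Nonempty (X v)] (m : V) (F : (∀ v, X v) → ℝ)
    (g : X m → (∀ v, X v) → ℝ)
    (hF : ∀ x y, (∀ v, v ≠ m → x v = y v) → F x = F y)
    (hg : ∀ a x y, (∀ v, v ≠ m → x v = y v) → g a x = g a y)
    (hsum : ∀ x, ∑ a, g a x = 1) (z : X m) :
    ∑ x, F x * g (x m) x = ∑ r, F ((Equiv.piSplitAt m X).symm (z, r)) := by
  rw [← (Equiv.piSplitAt m X).symm.sum_comp, Fintype.sum_prod_type_right]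
  refine Finset.sum_congr rfl fun r _ => ?_
  have key : ∀ y, ∀ v, v ≠ m → (Equiv.piSplitAt m X).symm (y, r) v =
      (Equiv.piSplitAt m X).symm (z, r) v := fun y v hv => by
    simp [Equiv.piSplitAt, hv]
  calc _ = ∑ y, F ((Equiv.piSplitAt m X).symm (z, r)) *
        g y ((Equiv.piSplitAt m X).symm (z, r)) := by
        refine Finset.sum_congr rfl fun y _ => ?_
        rw [hF _ _ (key y), hg _ _ _ (key y)]
        simp [Equiv.piSplitAt]
    _ = _ := by rw [← Finset.mul_sum, hsum, mul_one]

theorem sum_prod_kernel_aux [∀ v, Nonempty (X v)] (hE : IsDAG E) (n : ℕ) :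
    ∀ (S : Finset V) (k : ∀ s, X s → (∀ v, X v) → ℝ), S.card = n →
      (∀ s, IsKernel X E s (k s)) →
      (∀ s ∉ S, IsKernel X (fun _ _ => False) s (k s)) →
      ∑ x, ∏ s, k s (x s) x = 1 := by
  classical
  induction n with
  | zero =>
    intro S k hS _ hk'
    rw [Finset.card_eq_zero] at hS
    subst hS
    obtain ⟨z⟩ : Nonempty (∀ v, X v) := inferInstance
    have h0 : ∀ x : ∀ v, X v, ∏ s, k s (x s) x = ∏ s, k s (x s) z := fun x =>
      Finset.prod_congr rfl fun s _ => (hk' s (by simp)).2.1 _ _ _ fun _ h => h.elim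
    simp_rw [h0]
    rw [← Fintype.prod_sum fun s a => k s a z]
    exact Finset.prod_eq_one fun s _ => (hk' s (by simp)).2.2 z
  | succ n ih =>
    intro S k hS hk hk'
    obtain ⟨m, hm, hmS⟩ := hE.exists_no_child (Finset.card_pos.mp (by omega : 0 < S.card))
    obtain ⟨z⟩ : Nonempty (X m) := inferInstance
    let δ : X m → (∀ v, X v) → ℝ := fun y _ => if y = z then 1 else 0
    have hmm : ¬ E m m := fun h => hE m (Relation.TransGen.single h)
    have hF : ∀ x y : ∀ v, X v, (∀ v, v ≠ m → x v = y v) →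
        ∏ s ∈ univ.erase m, k s (x s) x = ∏ s ∈ univ.erase m, k s (y s) y := by
      intro x y hxy
      refine Finset.prod_congr rfl fun s hs => ?_
      rw [hxy s (Finset.ne_of_mem_erase hs)]
      by_cases hsS : s ∈ S
      · exact (hk s).2.1 _ _ _ fun t ht => hxy t fun h => hmS s hsS (h ▸ ht)
      · exact (hk' s hsS).2.1 _ _ _ fun _ h => h.elim
    have hupd := ih (S.erase m) (Function.update k m δ)
      (by rw [Finset.card_erase_of_mem hm]; omega)
      (fun s => by
        rcases eq_or_ne s m with rfl | hs
        · simpa using isKernel_pointMass s z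
        · simpa [hs] using hk s)
      (fun s hsS => by
        rcases eq_or_ne s m with rfl | hs
        · simpa using isKernel_pointMass s z
        · simpa [hs] using hk' s fun h => hsS (Finset.mem_erase.mpr ⟨hs, h⟩))
    rw [← hupd]
    have h1 : ∀ x : ∀ v, X v, ∏ s, k s (x s) x =
        (∏ s ∈ univ.erase m, k s (x s) x) * k m (x m) x := fun x =>
      (Finset.prod_erase_mul _ _ (Finset.mem_univ m)).symm
    have h2 : ∀ x : ∀ v, X v, ∏ s, Function.update k m δ s (x s) x =
        (∏ s ∈ univ.erase m, k s (x s) x) * δ (x m) x := fun x => by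
      rw [← Finset.prod_erase_mul _ _ (Finset.mem_univ m), Function.update_self]
      congr 1
      exact Finset.prod_congr rfl fun s hs => by
        rw [Function.update_of_ne (Finset.ne_of_mem_erase hs)]
    simp_rw [h1, h2]
    rw [sum_mul_kernel m _ (k m) hF
        (fun a x y hxy => (hk m).2.1 a x y fun t ht => hxy t fun h => hmm (h ▸ ht))
        (hk m).2.2 z,
      sum_mul_kernel m _ δ hF (fun _ _ _ _ => rfl) (isKernel_pointMass (E := E) m z).2.2 z]

/-- A product of kernels over a DAG is normalized. -/
theorem sum_prod_kernel [∀ v, Nonempty (X v)] (hE : IsDAG E)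
    {k : ∀ s, X s → (∀ v, X v) → ℝ} (hk : ∀ s, IsKernel X E s (k s)) :
    ∑ x, ∏ s, k s (x s) x = 1 :=
  sum_prod_kernel_aux hE _ univ k rfl hk fun s hs => (hs (Finset.mem_univ s)).elim

end Kernels

open Classical in
/-- The kernels of the distribution under which `t₁` and `t₂` are independent and uniform on the
two states given by `a` and `b`, `s` is in state `a s` or `b s` according to whether `t₁` and `t₂`
agree, and all other nodes `v` are in state `a v`. -/
noncomputable def xorKernel {V : Type*} {X : V → Type*} (a b : ∀ v, X v) (s t₁ t₂ : V)
    (v : V) (y : X v) (x : ∀ v, X v) : ℝ :=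
  if v = t₁ ∨ v = t₂ then (if y = a v then 1 / 2 else 0) + (if y = b v then 1 / 2 else 0)
  else if v = s then
    (if y = (if (x t₁ = a t₁ ↔ x t₂ = a t₂) then a v else b v) then 1 else 0)
  else if y = a v then 1 else 0

theorem isKernel_xorKernel {V : Type*} {X : V → Type*} [∀ v, Fintype (X v)]
    {E : V → V → Prop} {s t₁ t₂ : V} (a b : ∀ v, X v)
    (h₁ : E t₁ s) (h₂ : E t₂ s) (v : V) : IsKernel X E v (xorKernel a b s t₁ t₂ v) := by
  classical
  refine ⟨fun y x => ?_, fun y x x' hx => ?_, fun x => ?_⟩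
  · unfold xorKernel
    split_ifs <;> norm_num
  · unfold xorKernel
    by_cases hv : v = s
    · subst hv
      rw [hx _ h₁, hx _ h₂]
    · simp only [hv, if_false]
  · unfold xorKernel
    by_cases ht : v = t₁ ∨ v = t₂
    · simp only [ht, if_true, Finset.sum_add_distrib, Finset.sum_ite_eq', Finset.mem_univ]
      norm_num
    · simp only [ht, if_false]
      split_ifs <;> simp only [Finset.sum_ite_eq', Finset.mem_univ, if_true]

theorem joined_of_common_child {V : Type*} [Fintype V] [DecidableEq V]
    (X : V → Type*) [∀ v, Fintype (X v)] (h2 : ∀ v, 1 < Fintype.card (X v))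
    (E E' : V → V → Prop) (hE : IsDAG E) (hE' : IsDAG E')
    (hPP : ∀ p : (∀ v, X v) → ℝ, IsPMF X p → Factorizes X E p → Factorizes X E' p)
    (hrev : ∀ s t, E s t → E' t s) {s t₁ t₂ : V} (h₁ : E t₁ s) (h₂ : E t₂ s)
    (hne : t₁ ≠ t₂) : GJoined E' t₁ t₂ := by
  classical
  by_contra hj
  rw [GJoined, not_or] at hj
  choose a b hab using fun v => Fintype.exists_pair_of_one_lt_card (h2 v)
  have : ∀ v, Nonempty (X v) := fun v => ⟨a v⟩
  have irr : ∀ {F : V → V → Prop}, IsDAG F → ∀ v, ¬ F v v := fun hF v h =>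
    hF v (Relation.TransGen.single h)
  have hs₁ : s ≠ t₁ := fun h => irr hE s (by rw [← h] at h₁; exact h₁)
  have hs₂ : s ≠ t₂ := fun h => irr hE s (by rw [← h] at h₂; exact h₂)
  have asymm' : ∀ {u v}, E' u v → ¬ E' v u := fun h h' =>
    hE' _ ((Relation.TransGen.single h).tail h')
  have hks := isKernel_xorKernel (E := E) a b h₁ h₂
  set p : (∀ v, X v) → ℝ := fun x => ∏ v, xorKernel a b s t₁ t₂ v (x v) x with hp
  have hpsum : ∑ x, p x = 1 := sum_prod_kernel hE hks
  have hpos : ∀ x, 0 ≤ p x := fun x => Finset.prod_nonneg fun v _ => (hks v).1 _ _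
  obtain ⟨k, hk, hpk⟩ := hPP p ⟨hpos, hpsum⟩ ⟨_, hks, fun _ => rfl⟩
  let k' : ∀ v, X v → (∀ v, X v) → ℝ := fun v =>
    if v = s ∨ v = t₁ ∨ v = t₂ then k v else fun y _ => if y = a v then 1 else 0
  have hk' : ∀ v, IsKernel X E' v (k' v) := fun v => by
    simp only [k']
    split_ifs
    · exact hk v
    · exact isKernel_pointMass v (a v)
  have hle : ∀ x, p x ≤ ∏ v, k' v (x v) x := by
    intro x
    by_cases hx : ∀ v, ¬ (v = s ∨ v = t₁ ∨ v = t₂) → x v = a v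
    · rw [hpk]
      refine Finset.prod_le_prod (fun v _ => (hk v).1 _ _) fun v _ => ?_
      by_cases hv : v = s ∨ v = t₁ ∨ v = t₂
      · simp only [k', hv, if_true, le_refl]
      · simp only [k', hv, if_false, hx v hv, if_true]
        exact (hk v).le_one _ _
    · push Not at hx
      obtain ⟨v, hv, hxv⟩ := hx
      have : p x = 0 := by
        refine Finset.prod_eq_zero (Finset.mem_univ v) ?_
        simp [xorKernel, hv, hxv]
      rw [this]
      exact Finset.prod_nonneg fun v _ => (hk' v).1 _ _
  have heq : ∀ x, p x = ∏ v, k' v (x v) x := by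
    have := (Finset.sum_eq_sum_iff_of_le fun x (_ : x ∈ univ) => hle x).mp
      (hpsum.trans (sum_prod_kernel hE' hk').symm)
    exact fun x => this x (Finset.mem_univ x)
  let c : ∀ v, X v := Function.update a t₂ (b t₂)
  let d : ∀ v, X v := Function.update c t₁ (b t₁)
  have hpa : p a ≠ 0 := by
    refine Finset.prod_ne_zero_iff.mpr fun v _ => ?_
    by_cases hv : v = t₁ ∨ v = t₂ <;> simp [xorKernel, hv, hab]
  have hpd : p d ≠ 0 := by
    refine Finset.prod_ne_zero_iff.mpr fun v _ => ?_
    have hd₁ : d t₁ = b t₁ := by simp [d]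
    have hd₂ : d t₂ = b t₂ := by simp [d, c, hne.symm]
    by_cases hv₁ : v = t₁
    · subst hv₁
      simp [xorKernel, hd₁, (hab _).symm]
    by_cases hv₂ : v = t₂
    · subst hv₂
      simp [xorKernel, hd₂, (hab _).symm]
    have hd : d v = a v := by simp [d, c, hv₁, hv₂]
    simp [xorKernel, hv₁, hv₂, hd, hd₁, hd₂, (hab _).symm]
  have hpc : p c = 0 := by
    refine Finset.prod_eq_zero (Finset.mem_univ s) ?_
    simp [xorKernel, c, hs₁, hs₂, hne, hab, (hab _).symm]
  have hka : ∀ v, k v (a v) a ≠ 0 := fun v =>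
    Finset.prod_ne_zero_iff.mp (hpk a ▸ hpa) v (Finset.mem_univ v)
  have hkd : ∀ v, k v (d v) d ≠ 0 := fun v =>
    Finset.prod_ne_zero_iff.mp (hpk d ▸ hpd) v (Finset.mem_univ v)
  refine Finset.prod_ne_zero_iff.mpr (fun v _ => ?_) ((heq c).symm.trans hpc)
  have hca : ∀ t, t ≠ t₂ → c t = a t := fun t ht => by simp [c, ht]
  have hcd : ∀ t, t ≠ t₁ → c t = d t := fun t ht => by simp [d, ht]
  by_cases hv : v = s ∨ v = t₁ ∨ v = t₂
  · simp only [k', hv, if_true]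
    by_cases hv₂ : v = t₂
    · subst hv₂
      rw [(hk v).2.1 _ c d fun t ht => hcd t fun h => hj.1 (h ▸ ht), hcd v hne.symm]
      exact hkd v
    · rw [(hk v).2.1 _ c a fun t ht => hca t fun h => ?_, hca v hv₂]
      · exact hka v
      · subst h
        rcases hv with rfl | rfl | rfl
        · exact asymm' ht (hrev _ _ h₂)
        · exact hj.2 ht
        · exact hv₂ rfl
  · have : v ≠ t₂ := fun h => hv (Or.inr (Or.inr h))
    simp [k', hv, hca v this]

/-- if `P^{G'} ⊇ P^G` and `G' ⊇ G*`, then the skeleton of `G'` contains the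
moral graph of `G`; in particular any two distinct parents in `G` of a common node are
joined in `G'`. -/
theorem stmt11 {V : Type*} [Fintype V] [DecidableEq V] [Nonempty V]
    (X : V → Type*) [∀ v, Fintype (X v)] (h2 : ∀ v, 1 < Fintype.card (X v))
    (E E' : V → V → Prop) (hE : IsDAG E) (hE' : IsDAG E')
    (hPP : ∀ p : (∀ v, X v) → ℝ, IsPMF X p → Factorizes X E p → Factorizes X E' p)
    (hrev : ∀ s t, E s t → E' t s) :
    (∀ a b, MoralEdge E a b → GJoined E' a b) ∧
    ∀ s t₁ t₂, E t₁ s → E t₂ s → t₁ ≠ t₂ → GJoined E' t₁ t₂ := by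
  have key : ∀ s t₁ t₂, E t₁ s → E t₂ s → t₁ ≠ t₂ → GJoined E' t₁ t₂ := fun _ _ _ h₁ h₂ hne =>
    joined_of_common_child X h2 E E' hE hE' hPP hrev h₁ h₂ hne
  refine ⟨?_, key⟩
  rintro a b (h | h | ⟨hne, s, ha, hb⟩)
  · exact Or.inr (hrev _ _ h)
  · exact Or.inl (hrev _ _ h)
  · exact key s a b ha hb hne
end

section
/- Let G=(N,E) and G'=(N,E') be DAGs on the same node set with each state space X_s having at least two elements, such that P^{G'} ⊇ P^G, E' ⊇ E* (G' contains all edges of G reversed), and G has exactly one root; let O' be a topological ordering of G'. If r,u,v ∈ N satisfy O'(v) < O'(u) < O'(r) and (r,v) ∈ E, then (v,u) ∈ E'. -/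
open Finset

/-- A configuration whose kernel factors are positive up to the position of `u` in a topological
ordering extends, without changing it up to `u`, to one all of whose kernel factors are
positive. -/
lemma exists_extension_kernel_pos {V : Type*} [Fintype V] [DecidableEq V]
    (X : V → Type*) [∀ v, Fintype (X v)] {E : V → V → Prop}
    {O : V → Fin (Fintype.card V)} (hO : IsTopo E O)
    {k : ∀ s, X s → (∀ v, X v) → ℝ} (hk : ∀ s, IsKernel X E s (k s))
    (u : V) (y₀ : ∀ v, X v) (h₀ : ∀ s, O s ≤ O u → 0 < k s (y₀ s) y₀) :
    ∃ y : ∀ v, X v, (∀ s, O s ≤ O u → y s = y₀ s) ∧ ∀ s, 0 < k s (y s) y := by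
  suffices H : ∀ m : ℕ, ∃ y : ∀ v, X v, (∀ s, O s ≤ O u → y s = y₀ s) ∧
      ∀ s, (O s : ℕ) < m → 0 < k s (y s) y by
    obtain ⟨y, hy, hy'⟩ := H (Fintype.card V)
    exact ⟨y, hy, fun s => hy' s (O s).isLt⟩
  intro m
  induction m with
  | zero => exact ⟨y₀, fun _ _ => rfl, fun s hs => absurd hs (Nat.not_lt_zero _)⟩
  | succ m ih =>
    obtain ⟨y, hy, hpos⟩ := ih
    by_cases ht : ∃ t, (O t : ℕ) = m
    swap
    · refine ⟨y, hy, fun s hs => hpos s ?_⟩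
      have : (O s : ℕ) ≠ m := fun h => ht ⟨s, h⟩
      omega
    obtain ⟨t, rfl⟩ := ht
    by_cases htu : O t ≤ O u
    · refine ⟨y, hy, fun s hs => ?_⟩
      have hst : O s ≤ O t := Nat.lt_succ_iff.mp hs
      rw [hy s (hst.trans htu), (hk s).2.1 _ y y₀
        fun w hw => hy w ((hO.2 w s hw).le.trans (hst.trans htu))]
      exact h₀ s (hst.trans htu)
    obtain ⟨a, ha⟩ : ∃ a, 0 < k t a y := by
      by_contra! h
      have hsum := Finset.sum_nonpos fun a (_ : a ∈ Finset.univ) => h a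
      rw [(hk t).2.2 y] at hsum
      linarith
    refine ⟨Function.update y t a, fun s hs => ?_, fun s hs => ?_⟩
    · have hst : s ≠ t := by
        rintro rfl
        exact htu hs
      rw [Function.update_of_ne hst]
      exact hy s hs
    · have hst : O s ≤ O t := Nat.lt_succ_iff.mp hs
      rw [(hk s).2.1 _ (Function.update y t a) y fun w hw => by
        refine Function.update_of_ne ?_ _ _
        rintro rfl
        exact absurd (hO.2 w s hw) (not_lt.mpr hst)]
      by_cases h : s = t
      · subst h
        simpa using ha
      · rw [Function.update_of_ne h]
        refine hpos s (lt_of_le_of_ne hst fun h' => h (hO.1 (Fin.ext h')))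

open Classical in
/-- Send one fair bit from the root `ρ` along the edges `π s → s` to all nodes of `W`, keeping the
other nodes constant. The resulting pmf, with two atoms of mass `1 / 2`, factorizes. -/
lemma exists_factorizing_two_atoms {V : Type*} [Fintype V] [DecidableEq V]
    (X : V → Type*) [∀ v, Fintype (X v)] {E : V → V → Prop}
    {O : V → Fin (Fintype.card V)} (hO : ∀ s t, E s t → O t < O s)
    (c₀ c₁ : ∀ v, X v) (hc : ∀ v, c₀ v ≠ c₁ v) (ρ : V) (π : V → V)
    (hπ : ∀ s, s ≠ ρ → E (π s) s) (W : Set V) (hρW : ρ ∈ W)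
    (hW : ∀ s ∈ W, s ≠ ρ → π s ∈ W) :
    ∃ p : (∀ v, X v) → ℝ, IsPMF X p ∧ Factorizes X E p ∧
      ∀ x, 0 < p x ↔ x = c₀ ∨ x = fun s => if s ∈ W then c₁ s else c₀ s := by
  set x₁ : ∀ v, X v := fun s => if s ∈ W then c₁ s else c₀ s with hx₁
  have hne : c₀ ≠ x₁ := fun h => hc ρ (by
    have := congrFun h ρ
    simpa [hx₁, hρW] using this)
  let p : (∀ v, X v) → ℝ := fun x =>
    (if x = c₀ then 1 / 2 else 0) + (if x = x₁ then 1 / 2 else 0)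
  let g : ∀ s, (∀ v, X v) → X s := fun s x =>
    if s ∈ W ∧ x (π s) = c₁ (π s) then c₁ s else c₀ s
  let k : ∀ s, X s → (∀ v, X v) → ℝ := fun s a x =>
    if s = ρ then (if a = c₀ s then 1 / 2 else 0) + (if a = c₁ s then 1 / 2 else 0)
    else if a = g s x then 1 else 0
  have hg₀ : ∀ s, g s c₀ = c₀ s := fun s => by simp [g, hc]
  have hg₁ : ∀ s, s ≠ ρ → g s x₁ = x₁ s := fun s hs => by
    by_cases h : s ∈ W
    · simp [g, hx₁, h, hW s h hs]
    · simp [g, hx₁, h]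
  refine ⟨p, ⟨fun x => ?_, ?_⟩, ⟨k, fun s => ⟨fun a x => ?_, fun a x y hxy => ?_, fun x => ?_⟩,
    fun x => ?_⟩, fun x => ?_⟩
  · simp only [p]
    positivity
  · simp only [p, Finset.sum_add_distrib, Finset.sum_ite_eq', Finset.mem_univ, if_true]
    norm_num
  · simp only [k]
    positivity
  · by_cases hs : s = ρ
    · simp [k, hs]
    · simp only [k, g, hxy _ (hπ s hs)]
  · by_cases hs : s = ρ
    · simp only [k, hs, if_true, Finset.sum_add_distrib, Finset.sum_ite_eq', Finset.mem_univ]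
      norm_num
    · simp [k, hs]
  · by_cases h0 : x = c₀
    · subst h0
      rw [Finset.prod_eq_single ρ (fun s _ hs => by simp [k, hs, hg₀]) (by simp)]
      simp [p, k, hne, hc]
    by_cases h1 : x = x₁
    · subst h1
      rw [Finset.prod_eq_single ρ (fun s _ hs => by simp [k, hs, hg₁]) (by simp)]
      simp only [p, if_neg hne.symm, k, if_true]
      simp [hx₁, hρW, (hc ρ).symm]
    have hpx : p x = 0 := by simp [p, h0, h1]
    rw [hpx]
    symm
    by_contra hprod
    have hk := fun s => Finset.prod_ne_zero_iff.mp hprod s (Finset.mem_univ s)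
    have hx : ∀ s, s ≠ ρ → x s = g s x := fun s hs => by
      by_contra h
      exact hk s (by simp [k, hs, h])
    have wf : WellFounded fun a b => O a > O b := InvImage.wf O wellFounded_gt
    have hρ : x ρ = c₀ ρ ∨ x ρ = c₁ ρ := by
      by_contra! h
      exact hk ρ (by simp [k, h])
    rcases hρ with hρ | hρ
    · refine h0 (funext fun s => ?_)
      induction s using wf.induction with
      | _ s ih =>
        by_cases hs : s = ρ
        · rw [hs, hρ]
        · rw [hx s hs]
          simp [g, ih (π s) (hO _ _ (hπ s hs)), hc]
    · refine h1 (funext fun s => ?_)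
      induction s using wf.induction with
      | _ s ih =>
        by_cases hs : s = ρ
        · rw [hs, hρ]
          simp [hx₁, hρW]
        · rw [hx s hs, ← hg₁ s hs]
          simp only [g, ih (π s) (hO _ _ (hπ s hs))]
  · by_cases h0 : x = c₀
    · simp only [p, h0, true_or, iff_true, if_true]
      positivity
    by_cases h1 : x = x₁
    · simp only [p, h1, or_true, iff_true, if_true]
      positivity
    simp [p, h0, h1]

/-- Lemma: under `P^{G'} ⊇ P^G`, `G' ⊇ G*`, `|roots(G)| = 1`, with `O'` a
topological ordering of `G'`: if `O'(v) < O'(u) < O'(r)` and `r → v` in `G`, then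
`v → u` in `G'`. -/
theorem stmt13 {V : Type*} [Fintype V] [DecidableEq V] [Nonempty V]
    (X : V → Type*) [∀ v, Fintype (X v)] (h2 : ∀ v, 1 < Fintype.card (X v))
    (E E' : V → V → Prop) (hE : IsDAG E) (hE' : IsDAG E')
    (hPP : ∀ p : (∀ v, X v) → ℝ, IsPMF X p → Factorizes X E p → Factorizes X E' p)
    (hrev : ∀ s t, E s t → E' t s)
    (hroot : ∃! r : V, ∀ t, ¬ E t r)
    (O' : V → Fin (Fintype.card V)) (hO' : IsTopo E' O')
    (r u v : V) (hvu : O' v < O' u) (hur : O' u < O' r) (hrv : E r v) :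
    E' v u := by
  classical
  by_contra hvu'
  obtain ⟨ρ, hρ, hρu⟩ := hroot
  have hOE : ∀ s t, E s t → O' t < O' s := fun s t h => hO'.2 t s (hrev s t h)
  have hρmax : ∀ s, O' s ≤ O' ρ := by
    obtain ⟨m, hm⟩ := Finite.exists_max O'
    have : m = ρ := hρu m fun t ht => absurd (hOE t m ht) (not_lt.mpr (hm t))
    exact this ▸ hm
  have hpar : ∀ s, ∃ t, (s ≠ ρ → E t s) ∧ (s = v → t = r) := fun s => by
    by_cases hsv : s = v
    · exact ⟨r, fun _ => hsv ▸ hrv, fun _ => rfl⟩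
    by_cases hs : s = ρ
    · exact ⟨s, fun h => absurd hs h, fun h => absurd h hsv⟩
    have : ∃ t, E t s := by
      by_contra! h
      exact hs (hρu s h)
    obtain ⟨t, ht⟩ := this
    exact ⟨t, fun _ => ht, fun h => absurd h hsv⟩
  choose π hπ hπv using hpar
  have hcard : ∀ v, ∃ c : X v × X v, c.1 ≠ c.2 := fun v => by
    obtain ⟨a, b, hab⟩ := Fintype.one_lt_card_iff.mp (h2 v)
    exact ⟨(a, b), hab⟩
  choose c hc using hcard
  let W : Set V := {s | O' u ≤ O' s ∨ s = v}
  have hW : ∀ s ∈ W, s ≠ ρ → π s ∈ W := by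
    rintro s (hs | hs) hsρ
    · exact Or.inl (hs.trans (hOE _ _ (hπ s hsρ)).le)
    · exact Or.inl (by
        rw [hπv s hs]
        exact hur.le)
  obtain ⟨p, hp, hpE, hpos⟩ := exists_factorizing_two_atoms X hOE (fun v => (c v).1)
    (fun v => (c v).2) hc ρ π hπ W (Or.inl (hρmax u)) hW
  obtain ⟨k, hk, hpk⟩ := hPP p hp hpE
  set x₀ : ∀ v, X v := fun v => (c v).1 with hx₀
  set x₁ : ∀ v, X v := fun s => if s ∈ W then (c s).2 else (c s).1 with hx₁
  have hkpos : ∀ x, 0 < p x → ∀ s, 0 < k s (x s) x := fun x hx s => by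
    refine lt_of_le_of_ne ((hk s).1 _ _) fun h => ?_
    rw [hpk x, Finset.prod_eq_zero (Finset.mem_univ s) h.symm] at hx
    exact lt_irrefl _ hx
  have hk₀ := hkpos x₀ ((hpos _).mpr (Or.inl rfl))
  have hk₁ := hkpos x₁ ((hpos _).mpr (Or.inr (by convert rfl)))
  have huW : u ∈ W := Or.inl le_rfl
  have hvW : v ∈ W := Or.inr rfl
  have hne : v ≠ u := fun h => hvu.ne (h ▸ rfl)
  obtain ⟨y, hy, hypos⟩ := exists_extension_kernel_pos X hO' hk u
    (Function.update x₁ u (x₀ u)) fun s hs => by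
      by_cases hsu : s = u
      · subst hsu
        rw [Function.update_self, (hk s).2.1 _ _ x₀]
        · exact hk₀ s
        · intro t ht
          have hts := hO'.2 t s ht
          have htW : t ∉ W := by
            rintro (h | h)
            · exact absurd hts (not_lt.mpr h)
            · exact hvu' (h ▸ ht)
          rw [Function.update_of_ne fun h => hts.ne (congrArg O' h)]
          simp [hx₁, hx₀, htW]
      · rw [Function.update_of_ne hsu, (hk s).2.1 _ _ x₁]
        · exact hk₁ s
        · intro t ht
          refine Function.update_of_ne (fun h => ?_) _ _
          exact absurd (hO'.2 t s ht) (not_lt.mpr (h ▸ hs))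
  have hyu : y u = (c u).1 := by simp [hy u le_rfl, hx₀]
  have hyv : y v = (c v).2 := by simp [hy v hvu.le, hne, hx₁, hvW]
  have hpy : 0 < p y := by
    rw [hpk y]
    exact Finset.prod_pos fun s _ => hypos s
  rcases (hpos y).mp hpy with h | h
  · exact hc v ((congrFun h v).symm.trans hyv)
  · refine hc u (hyu.symm.trans ((congrFun h u).trans ?_))
    simp [huW]
end

section
/- Every perfect DAG with exactly one leaf has a unique topological ordering. That is, if G=(N,E) is a DAG such that pa_G(s) is complete for every s ∈ N and |leaves(G)|=1, then there is exactly one injective map O:N→{1,...,|N|} such that (s,t)∈E implies O(s)<O(t). -/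
open Finset

theorem IsDAG.wellFounded {V : Type*} [Finite V] {E : V → V → Prop} (hE : IsDAG E) :
    WellFounded E := by
  have : Std.Irrefl (Relation.TransGen E) := ⟨hE⟩
  exact Subrelation.wf Relation.TransGen.single
    (Finite.wellFounded_of_trans_of_irrefl (Relation.TransGen E))

theorem IsDAG.swap {V : Type*} {E : V → V → Prop} (hE : IsDAG E) :
    IsDAG (Function.swap E) :=
  fun s h => hE s (Relation.transGen_swap.1 h)

/-- In a finite DAG every node has a leaf among itself and its descendants. -/
theorem IsDAG.exists_leaf {V : Type*} [Finite V] {E : V → V → Prop} (hE : IsDAG E) (a : V) :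
    ∃ l, Relation.ReflTransGen E a l ∧ ∀ t, ¬ E l t := by
  induction a using hE.swap.wellFounded.induction with
  | _ a ih =>
    by_cases h : ∃ t, E a t
    · obtain ⟨t, ht⟩ := h
      obtain ⟨l, hl, hleaf⟩ := ih t ht
      exact ⟨l, .head ht hl, hleaf⟩
    · exact ⟨a, .refl, not_exists.1 h⟩

/-- In a finite perfect DAG any two ancestors of a node are comparable for reachability. -/
theorem GPerfect.reflTransGen_total_of_common {V : Type*} [Finite V] {E : V → V → Prop}
    (hperf : GPerfect E) (hE : IsDAG E) (c : V) :
    ∀ a b, Relation.ReflTransGen E a c → Relation.ReflTransGen E b c →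
      Relation.ReflTransGen E a b ∨ Relation.ReflTransGen E b a := by
  induction c using hE.wellFounded.induction with
  | _ c ih =>
    intro a b hac hbc
    rcases hac.cases_tail with rfl | ⟨p, hap, hpc⟩
    · exact .inr hbc
    rcases hbc.cases_tail with rfl | ⟨q, hbq, hqc⟩
    · exact .inl hac
    by_cases hpq : p = q
    · subst hpq
      exact ih p hpc a b hap hbq
    rcases hperf c p hpc q hqc hpq with h | h
    · exact ih q hqc a b (hap.tail h) hbq
    · exact ih p hpc a b hap (hbq.tail h)

theorem IsDAG.reflTransGen_antisymm {V : Type*} {E : V → V → Prop} (hE : IsDAG E) {a b : V}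
    (hab : Relation.ReflTransGen E a b) (hba : Relation.ReflTransGen E b a) : a = b := by
  rcases Relation.reflTransGen_iff_eq_or_transGen.1 hab with h | h
  · exact h.symm
  · exact (hE a (h.trans_left hba)).elim

/-- The reachability order of a DAG whose nodes are pairwise comparable for reachability. -/
noncomputable abbrev IsDAG.linearOrder {V : Type*} {E : V → V → Prop} (hE : IsDAG E)
    (htotal : ∀ a b, Relation.ReflTransGen E a b ∨ Relation.ReflTransGen E b a) :
    LinearOrder V where
  le := Relation.ReflTransGen E
  le_refl _ := .refl
  le_trans _ _ _ := .trans
  le_antisymm _ _ := hE.reflTransGen_antisymm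
  le_total := htotal
  toDecidableLE := Classical.decRel _

/-- Topological orderings are strictly increasing along nontrivial directed walks. -/
theorem IsTopo.lt_of_transGen {V : Type*} [Fintype V] {E : V → V → Prop}
    {O : V → Fin (Fintype.card V)} (hO : IsTopo E O) {a b : V} (h : Relation.TransGen E a b) :
    O a < O b := by
  induction h with
  | single h => exact hO.2 _ _ h
  | tail _ h ih => exact ih.trans (hO.2 _ _ h)

/-- every perfect DAG with exactly one leaf has a unique topological
ordering. -/
theorem stmt17 {V : Type*} [Fintype V] [DecidableEq V] [Nonempty V]
    (E : V → V → Prop) (hE : IsDAG E) (hperf : GPerfect E)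
    (hleaf : ∃! s : V, ∀ t, ¬ E s t) :
    ∃! O : V → Fin (Fintype.card V), IsTopo E O := by
  obtain ⟨l, -, hl⟩ := hleaf
  have hreach (a : V) : Relation.ReflTransGen E a l := by
    obtain ⟨m, ham, hm⟩ := hE.exists_leaf a
    exact hl m hm ▸ ham
  let := hE.linearOrder fun a b =>
    hperf.reflTransGen_total_of_common hE l a b (hreach a) (hreach b)
  let e : Fin (Fintype.card V) ≃o V := Fintype.orderIsoFinOfCardEq V rfl
  refine ⟨e.symm, ⟨e.symm.injective, fun s t hst => e.symm.strictMono ?_⟩, fun O hO => ?_⟩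
  · exact lt_of_le_of_ne (Relation.ReflTransGen.single hst) fun h => hE t (.single (h ▸ hst))
  · have hmono : StrictMono O := fun a b hab =>
      hO.lt_of_transGen ((Relation.reflTransGen_iff_eq_or_transGen.1 hab.le).resolve_left hab.ne')
    have hid : O ∘ e = id := by
      refine (StrictMono.range_inj (hmono.comp e.strictMono) strictMono_id).1 ?_
      rw [(Finite.injective_iff_surjective.1 (hO.1.comp e.injective)).range_eq, Set.range_id]
    funext v
    simpa using congrFun hid (e.symm v)
end

section
/- Reversing a covered edge of a DAG preserves acyclicity: if G=(N,E) is a DAG and (s,t) ∈ E is a covered edge, i.e. pa_G(t) = pa_G(s) ∪ {s}, then the directed graph (N, (E ∖ {(s,t)}) ∪ {(t,s)}) is also a DAG. -/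
open Finset

/-- Erasing the edge `(s, t)` from `r` and adding `(t, s)`: a walk either avoids the new edge, or
its initial segment up to `t` and its final segment from `s` avoid it. -/
theorem transGen_or_of_transGen_reverseEdge {V : Type*} {r : V → V → Prop} {s t a b : V}
    (h : Relation.TransGen (fun a b => (r a b ∧ ¬ (a = s ∧ b = t)) ∨ (a = t ∧ b = s)) a b) :
    Relation.TransGen (fun a b => r a b ∧ ¬ (a = s ∧ b = t)) a b ∨
      Relation.ReflTransGen (fun a b => r a b ∧ ¬ (a = s ∧ b = t)) a t ∧
        Relation.ReflTransGen (fun a b => r a b ∧ ¬ (a = s ∧ b = t)) s b := by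
  induction h with
  | single h =>
    rcases h with h | ⟨rfl, rfl⟩
    · exact .inl (.single h)
    · exact .inr ⟨.refl, .refl⟩
  | tail _ h ih =>
    rcases h with h | ⟨rfl, rfl⟩
    · exact ih.imp (·.tail h) (And.imp_right (·.tail h))
    · exact .inr ⟨ih.elim (·.to_reflTransGen) And.left, .refl⟩

/-- reversing a covered edge of a DAG preserves acyclicity. -/
theorem stmt18 {V : Type*} [Fintype V] [Nonempty V]
    (E : V → V → Prop) (hE : IsDAG E) (s t : V) (hst : E s t)
    (hcov : ∀ u, E u t ↔ (E u s ∨ u = s)) :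
    IsDAG (fun a b => (E a b ∧ ¬ (a = s ∧ b = t)) ∨ (a = t ∧ b = s)) := by
  intro a ha
  rcases transGen_or_of_transGen_reverseEdge ha with h | ⟨hat, hsa⟩
  · exact hE a (Relation.TransGen.mono (fun _ _ => And.left) _ _ h)
  · rcases (hsa.trans hat).cases_tail with rfl | ⟨u, hsu, hut, hne⟩
    · exact hE _ (.single hst)
    · rcases (hcov u).1 hut with hus | rfl
      · exact hE s (.tail' (Relation.ReflTransGen.mono (fun _ _ => And.left) _ _ hsu) hus)
      · exact hne ⟨rfl, rfl⟩
end
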